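/- The rate region R of (4,3,3) exact-repair regenerating codes is exactly the set of pairs (ᾱ, β̄) ∈ ℝ² satisfying the four inequalities 3ᾱ ≥ 1, 2ᾱ + β̄ ≥ 1, 4ᾱ + 6β̄ ≥ 3, and 6β̄ ≥ 1. -/

import Mathlib

/-- An `(N, K_d, K)` exact-repair regenerating code for `(n,k,d) = (4,3,3)`. -/
structure ExactRepairCode433 (N Kd K : ℕ) where
  f : Fin 4 → Fin N → Fin Kd
  F : Fin 4 → Fin 4 → Fin Kd → Fin K
  G : (j : Fin 4) → ({i : Fin 4 // i ≠ j} → Fin K) → Fin Kd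
  reconstruct : ∀ A : Finset (Fin 4), A.card = 3 →
    Function.Injective fun m : Fin N => fun i : A => f i m
  repair : ∀ (j : Fin 4) (m : Fin N),
    G j (fun i => F i.1 j (f i.1 m)) = f j m

/-- A normalized pair `(ᾱ, β̄)` is `(4,3,3)` exact-repair achievable. -/
def Achievable433 (α β : ℝ) : Prop :=
  ∀ ε : ℝ, 0 < ε → ∃ (N Kd K : ℕ), 2 ≤ N ∧ Nonempty (ExactRepairCode433 N Kd K) ∧
    α + ε ≥ Real.log Kd / Real.log N ∧ β + ε ≥ Real.log K / Real.log N



section Entropy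

open Finset

open scoped Classical in
/-- The number of points of `Ω` that `X` sends to `x`. -/
noncomputable def fiberCount {Ω τ : Type*} [Fintype Ω] (X : Ω → τ) (x : τ) : ℕ :=
  #{m | X m = x}

/-- The Shannon entropy of `X` when `Ω` carries the uniform distribution. -/
noncomputable def uniformEntropy {Ω τ : Type*} [Fintype Ω] (X : Ω → τ) : ℝ :=
  Real.log (Fintype.card Ω) - (∑ m, Real.log (fiberCount X (X m))) / Fintype.card Ω

variable {Ω τ τ₁ τ₂ τ₃ : Type*} [Fintype Ω]

theorem fiberCount_apply_pos (X : Ω → τ) (m : Ω) : 0 < fiberCount X (X m) := by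
  classical
  exact card_pos.2 ⟨m, by simp⟩

theorem fiberCount_apply_le_of_forall {X : Ω → τ₁} {Y : Ω → τ₂}
    (h : ∀ m m', X m = X m' → Y m = Y m') (m : Ω) :
    fiberCount X (X m) ≤ fiberCount Y (Y m) := by
  classical
  refine card_le_card fun m' hm' => ?_
  simp only [mem_filter, mem_univ, true_and] at hm' ⊢
  exact h _ _ hm'

theorem uniformEntropy_le_of_forall {X : Ω → τ₁} {Y : Ω → τ₂}
    (h : ∀ m m', X m = X m' → Y m = Y m') : uniformEntropy Y ≤ uniformEntropy X := by
  unfold uniformEntropy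
  gcongr with m
  · exact_mod_cast fiberCount_apply_pos X m
  · exact fiberCount_apply_le_of_forall h m

theorem uniformEntropy_of_injective {X : Ω → τ} (h : Function.Injective X) :
    uniformEntropy X = Real.log (Fintype.card Ω) := by
  classical
  have h1 (m : Ω) : fiberCount X (X m) = 1 := by
    rw [fiberCount, card_eq_one]
    exact ⟨m, by ext; simp [h.eq_iff]⟩
  simp [uniformEntropy, h1]

theorem uniformEntropy_const (c : τ) : uniformEntropy (fun _ : Ω => c) = 0 := by
  classical
  rcases isEmpty_or_nonempty Ω with hΩ | hΩ
  · simp [uniformEntropy]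
  · simp [uniformEntropy, fiberCount]

theorem uniformEntropy_nonneg (X : Ω → τ) : 0 ≤ uniformEntropy X :=
  uniformEntropy_const (Ω := Ω) () ▸ uniformEntropy_le_of_forall fun _ _ _ => rfl

/-- Gibbs' inequality in the form used for the entropy bounds below. -/
theorem sum_log_le_zero_of_sum_le {r : Ω → ℝ} (hr : ∀ m, 0 < r m)
    (h : ∑ m, r m ≤ Fintype.card Ω) : ∑ m, Real.log (r m) ≤ 0 := by
  calc ∑ m, Real.log (r m) ≤ ∑ m, (r m - 1) :=
        sum_le_sum fun m _ => Real.log_le_sub_one_of_pos (hr m)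
    _ = ∑ m, r m - Fintype.card Ω := by simp
    _ ≤ 0 := by linarith

theorem uniformEntropy_le_log_card [Nonempty Ω] [Fintype τ] (X : Ω → τ) :
    uniformEntropy X ≤ Real.log (Fintype.card τ) := by
  classical
  have hΩ : (0 : ℝ) < Fintype.card Ω := by exact_mod_cast Fintype.card_pos
  have hτ : (0 : ℝ) < Fintype.card τ := by
    have : Nonempty τ := Nonempty.map X inferInstance
    exact_mod_cast Fintype.card_pos
  have hc (m : Ω) : (0 : ℝ) < fiberCount X (X m) := by
    exact_mod_cast fiberCount_apply_pos X m
  have key := sum_log_le_zero_of_sum_le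
    (r := fun m => (Fintype.card Ω : ℝ) / (Fintype.card τ * fiberCount X (X m)))
    (fun m => div_pos hΩ (mul_pos hτ (hc m))) (by
      have hs := sum_comp (s := (univ : Finset Ω))
        (fun x => (Fintype.card Ω : ℝ) / (Fintype.card τ * fiberCount X x)) X
      rw [hs]
      calc _ ≤ ∑ x ∈ univ.image X, (Fintype.card Ω : ℝ) / Fintype.card τ := by
            refine sum_le_sum fun x hx => ?_
            obtain ⟨m, -, rfl⟩ := mem_image.1 hx
            have h2 : #{a | X a = X m} = fiberCount X (X m) := by
              unfold fiberCount; congr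
            have := hc m
            rw [h2, nsmul_eq_mul]
            apply le_of_eq
            field_simp
        _ ≤ ∑ x : τ, (Fintype.card Ω : ℝ) / Fintype.card τ :=
            sum_le_sum_of_subset_of_nonneg (subset_univ _) fun _ _ _ => by positivity
        _ = Fintype.card Ω := by
            simp
            field_simp)
  have hl (m : Ω) : Real.log ((Fintype.card Ω : ℝ) / (Fintype.card τ * fiberCount X (X m))) =
      Real.log (Fintype.card Ω) - Real.log (Fintype.card τ) - Real.log (fiberCount X (X m)) := by
    rw [Real.log_div hΩ.ne' (mul_pos hτ (hc m)).ne', Real.log_mul hτ.ne' (hc m).ne']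
    ring
  simp only [hl, sum_sub_distrib, sum_const, card_univ, nsmul_eq_mul] at key
  unfold uniformEntropy
  rw [sub_le_comm, le_div_iff₀ hΩ]
  linarith

theorem sum_fiberCount_prodMk [DecidableEq τ₁] (X : Ω → τ₁) (Z : Ω → τ₃) (z : τ₃) :
    ∑ x ∈ univ.image X, fiberCount (fun m => (X m, Z m)) (x, z) = fiberCount Z z := by
  classical
  unfold fiberCount
  rw [card_eq_sum_card_fiberwise (f := X) (t := univ.image X)
    (fun m _ => mem_coe.2 (mem_image_of_mem X (mem_univ m)))]
  refine sum_congr rfl fun x _ => ?_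
  rw [filter_filter]
  simp only [Prod.mk.injEq, and_comm]

theorem sum_fiberCount_ratio_le (X : Ω → τ₁) (Y : Ω → τ₂) (Z : Ω → τ₃) :
    ∑ m, (fiberCount (fun m => (X m, Z m)) (X m, Z m) : ℝ) *
        fiberCount (fun m => (Y m, Z m)) (Y m, Z m) /
        (fiberCount (fun m => (X m, Y m, Z m)) (X m, Y m, Z m) * fiberCount Z (Z m))
      ≤ Fintype.card Ω := by
  classical
  set a := fun x z => (fiberCount (fun m => (X m, Z m)) (x, z) : ℝ)
  set b := fun y z => (fiberCount (fun m => (Y m, Z m)) (y, z) : ℝ)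
  set W := fun m => (X m, Y m, Z m) with hW
  have hs := sum_comp (s := (univ : Finset Ω))
    (fun w : τ₁ × τ₂ × τ₃ => a w.1 w.2.2 * b w.2.1 w.2.2 /
      (fiberCount W w * fiberCount Z w.2.2)) W
  refine hs.trans_le ?_
  calc _ ≤ ∑ w ∈ univ.image W, a w.1 w.2.2 * b w.2.1 w.2.2 / fiberCount Z w.2.2 := by
        refine sum_le_sum fun w hw => ?_
        obtain ⟨m, -, rfl⟩ := mem_image.1 hw
        have h2 : #{a | W a = W m} = fiberCount W (W m) := by
          unfold fiberCount; congr
        have h3 : (0 : ℝ) < fiberCount W (W m) := by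
          exact_mod_cast fiberCount_apply_pos W m
        have h4 : (0 : ℝ) < fiberCount Z (W m).2.2 := by
          exact_mod_cast fiberCount_apply_pos Z m
        rw [h2, nsmul_eq_mul]
        apply le_of_eq
        field_simp
    _ ≤ ∑ w ∈ univ.image X ×ˢ univ.image Y ×ˢ univ.image Z,
          a w.1 w.2.2 * b w.2.1 w.2.2 / fiberCount Z w.2.2 := by
        refine sum_le_sum_of_subset_of_nonneg (fun w hw => ?_) fun _ _ _ => by positivity
        obtain ⟨m, -, rfl⟩ := mem_image.1 hw
        simp [W]
    _ = ∑ z ∈ univ.image Z, (∑ x ∈ univ.image X, a x z) * (∑ y ∈ univ.image Y, b y z) /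
          fiberCount Z z := by
        simp_rw [sum_product, sum_mul_sum, sum_div]
        rw [sum_congr rfl fun x _ => sum_comm, sum_comm]
    _ = ∑ z ∈ univ.image Z, (fiberCount Z z : ℝ) := by
        refine sum_congr rfl fun z _ => ?_
        have h1 : ∑ x ∈ univ.image X, a x z = fiberCount Z z := by
          simp only [a]
          exact_mod_cast sum_fiberCount_prodMk X Z z
        have h2 : ∑ y ∈ univ.image Y, b y z = fiberCount Z z := by
          simp only [b]
          exact_mod_cast sum_fiberCount_prodMk Y Z z
        rw [h1, h2, mul_self_div_self]
    _ ≤ Fintype.card Ω := by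
        have := card_eq_sum_card_image Z univ
        rw [card_univ] at this
        rw [this]
        push_cast
        refine sum_le_sum fun z _ => le_of_eq ?_
        unfold fiberCount; congr

theorem uniformEntropy_submodular (X : Ω → τ₁) (Y : Ω → τ₂) (Z : Ω → τ₃) :
    uniformEntropy (fun m => (X m, Y m, Z m)) + uniformEntropy Z ≤
      uniformEntropy (fun m => (X m, Z m)) + uniformEntropy (fun m => (Y m, Z m)) := by
  have h1 (m : Ω) : (0 : ℝ) < fiberCount (fun m => (X m, Z m)) (X m, Z m) := by
    exact_mod_cast fiberCount_apply_pos (fun m => (X m, Z m)) m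
  have h2 (m : Ω) : (0 : ℝ) < fiberCount (fun m => (Y m, Z m)) (Y m, Z m) := by
    exact_mod_cast fiberCount_apply_pos (fun m => (Y m, Z m)) m
  have h3 (m : Ω) : (0 : ℝ) < fiberCount (fun m => (X m, Y m, Z m)) (X m, Y m, Z m) := by
    exact_mod_cast fiberCount_apply_pos (fun m => (X m, Y m, Z m)) m
  have h4 (m : Ω) : (0 : ℝ) < fiberCount Z (Z m) := by
    exact_mod_cast fiberCount_apply_pos Z m
  have key := sum_log_le_zero_of_sum_le
    (fun m => div_pos (mul_pos (h1 m) (h2 m)) (mul_pos (h3 m) (h4 m)))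
    (sum_fiberCount_ratio_le X Y Z)
  have hl (m : Ω) := Real.log_div (mul_pos (h1 m) (h2 m)).ne' (mul_pos (h3 m) (h4 m)).ne'
  simp only [hl, Real.log_mul (h1 _).ne' (h2 _).ne', Real.log_mul (h3 _).ne' (h4 _).ne',
    sum_sub_distrib, sum_add_distrib] at key
  have := div_nonpos_of_nonpos_of_nonneg key (Nat.cast_nonneg (α := ℝ) (Fintype.card Ω))
  simp only [sub_div, add_div] at this
  unfold uniformEntropy
  linarith

end Entropy

/-! Labels for the random variables of a code: `(i, i)` is the content of node `i`, and
`(i, j)` with `i ≠ j` is the message that node `i` sends for the repair of node `j`. -/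

/-- The labels that become known after one round of evaluating repair encoders and decoders. -/
def repairStep (S : Finset (Fin 4 × Fin 4)) : Finset (Fin 4 × Fin 4) :=
  Finset.univ.filter fun l => l ∈ S ∨ (l.1, l.1) ∈ S ∨
    (l.1 = l.2 ∧ ∀ i, i ≠ l.2 → (i, l.2) ∈ S ∨ (i, i) ∈ S)

/-- Three rounds of `repairStep`. -/
def repairClosure (S : Finset (Fin 4 × Fin 4)) : Finset (Fin 4 × Fin 4) :=
  repairStep (repairStep (repairStep S))

theorem subset_repairStep (S : Finset (Fin 4 × Fin 4)) : S ⊆ repairStep S := fun l hl => by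
  simp [repairStep, hl]

theorem subset_repairClosure (S : Finset (Fin 4 × Fin 4)) : S ⊆ repairClosure S :=
  (subset_repairStep S).trans ((subset_repairStep _).trans (subset_repairStep _))

theorem repairStep_mono {S T : Finset (Fin 4 × Fin 4)} (h : S ⊆ T) :
    repairStep S ⊆ repairStep T := fun l hl => by
  simp only [repairStep, Finset.mem_filter, Finset.mem_univ, true_and] at hl ⊢
  exact hl.imp (@h _) (Or.imp (@h _) (And.imp_right fun h' i hi => (h' i hi).imp (@h _) (@h _)))

theorem repairClosure_mono {S T : Finset (Fin 4 × Fin 4)} (h : S ⊆ T) :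
    repairClosure S ⊆ repairClosure T :=
  repairStep_mono (repairStep_mono (repairStep_mono h))

namespace ExactRepairCode433

variable {N Kd K : ℕ} (C : ExactRepairCode433 N Kd K)

open Finset

/-- The random variable with a given label, after the nodes have been relabelled by `σ`. -/
def symbol (σ : Equiv.Perm (Fin 4)) (l : Fin 4 × Fin 4) (m : Fin N) : ℕ :=
  if l.1 = l.2 then C.f (σ l.1) m else C.F (σ l.1) (σ l.2) (C.f (σ l.1) m)

/-- The entropy of a family of labels, after the nodes have been relabelled by `σ`. -/
noncomputable def jointEntropy (σ : Equiv.Perm (Fin 4)) (S : Finset (Fin 4 × Fin 4)) : ℝ :=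
  uniformEntropy fun (m : Fin N) (l : S) => C.symbol σ l m

theorem symbol_eq_of_diag {σ : Equiv.Perm (Fin 4)} {m m' : Fin N} {i : Fin 4} (j : Fin 4)
    (h : C.symbol σ (i, i) m = C.symbol σ (i, i) m') :
    C.symbol σ (i, j) m = C.symbol σ (i, j) m' := by
  have h' : C.f (σ i) m = C.f (σ i) m' := by
    apply Fin.val_injective
    simpa [symbol] using h
  simp [symbol, h']

theorem symbol_diag_eq_of_incoming {σ : Equiv.Perm (Fin 4)} {m m' : Fin N} {j : Fin 4}
    (h : ∀ i, i ≠ j → C.symbol σ (i, j) m = C.symbol σ (i, j) m') :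
    C.symbol σ (j, j) m = C.symbol σ (j, j) m' := by
  have h' : C.f (σ j) m = C.f (σ j) m' := by
    rw [← C.repair (σ j) m, ← C.repair (σ j) m']
    congr 1
    funext ⟨i, hi⟩
    have hi' : σ.symm i ≠ j := fun h => hi (by simp [← h])
    apply Fin.val_injective
    simpa [symbol, hi'] using h _ hi'
  simp [symbol, h']

theorem symbol_eq_of_mem_repairStep {σ : Equiv.Perm (Fin 4)} {m m' : Fin N}
    {S : Finset (Fin 4 × Fin 4)} (h : ∀ l ∈ S, C.symbol σ l m = C.symbol σ l m') :
    ∀ l ∈ repairStep S, C.symbol σ l m = C.symbol σ l m' := by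
  rintro ⟨i, j⟩ hl
  simp only [repairStep, mem_filter, mem_univ, true_and] at hl
  rcases hl with hl | hl | ⟨rfl, hl⟩
  · exact h _ hl
  · exact C.symbol_eq_of_diag j (h _ hl)
  · exact C.symbol_diag_eq_of_incoming fun i' hi' => (hl i' hi').elim (h _)
      fun hi => C.symbol_eq_of_diag i (h _ hi)

theorem symbol_eq_of_mem_repairClosure {σ : Equiv.Perm (Fin 4)} {m m' : Fin N}
    {S : Finset (Fin 4 × Fin 4)} (h : ∀ l ∈ S, C.symbol σ l m = C.symbol σ l m') :
    ∀ l ∈ repairClosure S, C.symbol σ l m = C.symbol σ l m' :=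
  C.symbol_eq_of_mem_repairStep (C.symbol_eq_of_mem_repairStep
    (C.symbol_eq_of_mem_repairStep h))

theorem eq_of_symbol_eq {σ : Equiv.Perm (Fin 4)} {m m' : Fin N} {S : Finset (Fin 4 × Fin 4)}
    {k : Fin 4} (hS : ∀ i, i ≠ k → (i, i) ∈ repairClosure S)
    (h : ∀ l ∈ S, C.symbol σ l m = C.symbol σ l m') : m = m' := by
  refine C.reconstruct (univ.erase (σ k)) (by simp) (funext fun ⟨i, hi⟩ => ?_)
  have hi' : σ.symm i ≠ k := fun h => ne_of_mem_erase hi (by simp [← h])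
  apply Fin.val_injective
  simpa [symbol] using C.symbol_eq_of_mem_repairClosure h _ (hS _ hi')

theorem jointEntropy_mono {σ : Equiv.Perm (Fin 4)} {A B : Finset (Fin 4 × Fin 4)}
    (h : A ⊆ repairClosure B) : C.jointEntropy σ A ≤ C.jointEntropy σ B := by
  refine uniformEntropy_le_of_forall fun m m' hm => funext fun ⟨l, hl⟩ => ?_
  exact C.symbol_eq_of_mem_repairClosure (fun l hl => congrFun hm ⟨l, hl⟩) l (h hl)

theorem jointEntropy_eq_log {σ : Equiv.Perm (Fin 4)} {S : Finset (Fin 4 × Fin 4)} (k : Fin 4)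
    (hS : ∀ i, i ≠ k → (i, i) ∈ repairClosure S) : C.jointEntropy σ S = Real.log N := by
  rw [jointEntropy, uniformEntropy_of_injective, Fintype.card_fin]
  exact fun m m' hm => C.eq_of_symbol_eq hS fun l hl => congrFun hm ⟨l, hl⟩

theorem jointEntropy_submodular (σ : Equiv.Perm (Fin 4)) (A B : Finset (Fin 4 × Fin 4)) :
    C.jointEntropy σ (A ∪ B) + C.jointEntropy σ (A ∩ B) ≤
      C.jointEntropy σ A + C.jointEntropy σ B := by
  have key := uniformEntropy_submodular (fun (m : Fin N) (l : A) => C.symbol σ l m)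
    (fun m (l : B) => C.symbol σ l m) (fun m (l : (A ∩ B : Finset _)) => C.symbol σ l m)
  have hU : C.jointEntropy σ (A ∪ B) ≤ uniformEntropy (fun (m : Fin N) =>
      ((fun l : A => C.symbol σ l m), (fun l : B => C.symbol σ l m),
        (fun l : (A ∩ B : Finset _) => C.symbol σ l m))) := by
    refine uniformEntropy_le_of_forall fun m m' hm => funext fun ⟨l, hl⟩ => ?_
    simp only [Prod.mk.injEq] at hm
    rcases mem_union.1 hl with hl | hl
    · exact congrFun hm.1 ⟨l, hl⟩
    · exact congrFun hm.2.1 ⟨l, hl⟩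
  have hA : uniformEntropy (fun (m : Fin N) => ((fun l : A => C.symbol σ l m),
      (fun l : (A ∩ B : Finset _) => C.symbol σ l m))) ≤ C.jointEntropy σ A := by
    refine uniformEntropy_le_of_forall fun m m' hm => Prod.ext hm (funext fun ⟨l, hl⟩ => ?_)
    exact congrFun hm ⟨l, mem_of_mem_inter_left hl⟩
  have hB : uniformEntropy (fun (m : Fin N) => ((fun l : B => C.symbol σ l m),
      (fun l : (A ∩ B : Finset _) => C.symbol σ l m))) ≤ C.jointEntropy σ B := by
    refine uniformEntropy_le_of_forall fun m m' hm => Prod.ext hm (funext fun ⟨l, hl⟩ => ?_)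
    exact congrFun hm ⟨l, mem_of_mem_inter_right hl⟩
  have hI : C.jointEntropy σ (A ∩ B) = uniformEntropy (fun (m : Fin N)
      (l : (A ∩ B : Finset _)) => C.symbol σ l m) := rfl
  linarith

theorem jointEntropy_diag_le [NeZero N] (σ : Equiv.Perm (Fin 4)) (i : Fin 4) :
    C.jointEntropy σ {(i, i)} ≤ Real.log Kd := by
  have h := uniformEntropy_le_log_card (C.f (σ i))
  rw [Fintype.card_fin] at h
  refine (uniformEntropy_le_of_forall fun m m' hm => funext fun ⟨l, hl⟩ => ?_).trans h
  obtain rfl := mem_singleton.1 hl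
  simp [symbol, hm]

theorem jointEntropy_offDiag_le [NeZero N] (σ : Equiv.Perm (Fin 4)) {i j : Fin 4}
    (hij : i ≠ j) : C.jointEntropy σ {(i, j)} ≤ Real.log K := by
  have h := uniformEntropy_le_log_card fun m => C.F (σ i) (σ j) (C.f (σ i) m)
  rw [Fintype.card_fin] at h
  refine (uniformEntropy_le_of_forall fun m m' hm => funext fun ⟨l, hl⟩ => ?_).trans h
  obtain rfl := mem_singleton.1 hl
  simp [symbol, hij, hm]

theorem jointEntropy_image (σ τ : Equiv.Perm (Fin 4)) (S : Finset (Fin 4 × Fin 4)) :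
    C.jointEntropy σ (S.image (Prod.map τ τ)) = C.jointEntropy (σ * τ) S := by
  have hsym (l : Fin 4 × Fin 4) (m : Fin N) :
      C.symbol σ (Prod.map τ τ l) m = C.symbol (σ * τ) l m := by
    simp [symbol]
  apply le_antisymm
  · refine uniformEntropy_le_of_forall fun m m' hm => funext fun ⟨l, hl⟩ => ?_
    obtain ⟨l, hl', rfl⟩ := mem_image.1 hl
    simpa only [hsym] using congrFun hm ⟨l, hl'⟩
  · refine uniformEntropy_le_of_forall fun m m' hm => funext fun ⟨l, hl⟩ => ?_
    simpa only [hsym] using congrFun hm ⟨_, mem_image_of_mem _ hl⟩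

/-- The joint entropy averaged over all relabellings of the nodes. -/
noncomputable def meanEntropy (S : Finset (Fin 4 × Fin 4)) : ℝ :=
  (∑ σ, C.jointEntropy σ S) / 24

theorem meanEntropy_nonneg (S : Finset (Fin 4 × Fin 4)) : 0 ≤ C.meanEntropy S :=
  div_nonneg (sum_nonneg fun _ _ => uniformEntropy_nonneg _) (by norm_num)

theorem meanEntropy_image (τ : Equiv.Perm (Fin 4)) (S : Finset (Fin 4 × Fin 4)) :
    C.meanEntropy (S.image (Prod.map τ τ)) = C.meanEntropy S := by
  simp only [meanEntropy, jointEntropy_image]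
  congr 1
  exact Equiv.sum_comp (Equiv.mulRight τ) fun σ => C.jointEntropy σ S

theorem meanEntropy_mono {A B : Finset (Fin 4 × Fin 4)} (h : A ⊆ repairClosure B) :
    C.meanEntropy A ≤ C.meanEntropy B := by
  unfold meanEntropy
  gcongr
  exact C.jointEntropy_mono h

theorem card_perm_fin_four : (univ : Finset (Equiv.Perm (Fin 4))).card = 24 := by
  simp [Fintype.card_perm, Nat.factorial]

theorem meanEntropy_le_of_forall {S : Finset (Fin 4 × Fin 4)} {x : ℝ}
    (h : ∀ σ, C.jointEntropy σ S ≤ x) : C.meanEntropy S ≤ x := by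
  have := sum_le_card_nsmul univ _ x fun σ _ => h σ
  rw [card_perm_fin_four, nsmul_eq_mul] at this
  rw [meanEntropy, div_le_iff₀ (by norm_num)]
  push_cast at this
  linarith

theorem meanEntropy_eq_log {S : Finset (Fin 4 × Fin 4)} (k : Fin 4)
    (hS : ∀ i, i ≠ k → (i, i) ∈ repairClosure S) : C.meanEntropy S = Real.log N := by
  rw [meanEntropy, sum_congr rfl fun σ _ => C.jointEntropy_eq_log k hS, sum_const,
    card_perm_fin_four, nsmul_eq_mul]
  push_cast
  ring

theorem meanEntropy_union_add_inter_le (A B : Finset (Fin 4 × Fin 4)) :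
    C.meanEntropy (A ∪ B) + C.meanEntropy (A ∩ B) ≤ C.meanEntropy A + C.meanEntropy B := by
  unfold meanEntropy
  rw [← add_div, ← add_div, ← sum_add_distrib, ← sum_add_distrib]
  refine div_le_div_of_nonneg_right (sum_le_sum fun σ _ => ?_) (by norm_num)
  exact C.jointEntropy_submodular _ A B

theorem meanEntropy_repairClosure (A : Finset (Fin 4 × Fin 4)) :
    C.meanEntropy (repairClosure A) ≤ C.meanEntropy A :=
  C.meanEntropy_mono subset_rfl

theorem meanEntropy_le {A B : Finset (Fin 4 × Fin 4)} (τ : Equiv.Perm (Fin 4))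
    (h : A ⊆ repairClosure (B.image (Prod.map τ τ))) : C.meanEntropy A ≤ C.meanEntropy B :=
  C.meanEntropy_image τ B ▸ C.meanEntropy_mono h

theorem meanEntropy_submodular {U I A B : Finset (Fin 4 × Fin 4)}
    (hU : U ⊆ repairClosure (A ∪ B)) (hI : I ⊆ repairClosure A ∩ repairClosure B) :
    C.meanEntropy U + C.meanEntropy I ≤ C.meanEntropy A + C.meanEntropy B := by
  have h := C.meanEntropy_union_add_inter_le (repairClosure A) (repairClosure B)
  have h1 := C.meanEntropy_repairClosure A
  have h2 := C.meanEntropy_repairClosure B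
  have h3 : C.meanEntropy I ≤ C.meanEntropy (repairClosure A ∩ repairClosure B) :=
    C.meanEntropy_mono (hI.trans (subset_repairClosure _))
  have h4 : C.meanEntropy U ≤ C.meanEntropy (repairClosure A ∪ repairClosure B) :=
    C.meanEntropy_mono (hU.trans (repairClosure_mono
      (union_subset_union (subset_repairClosure _) (subset_repairClosure _))))
  linarith

theorem meanEntropy_union_le (A B : Finset (Fin 4 × Fin 4)) :
    C.meanEntropy (A ∪ B) ≤ C.meanEntropy A + C.meanEntropy B := by
  have := C.meanEntropy_union_add_inter_le A B
  have := C.meanEntropy_nonneg (A ∩ B)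
  linarith

theorem meanEntropy_empty_le : C.meanEntropy ∅ ≤ 0 :=
  C.meanEntropy_le_of_forall fun _ => uniformEntropy_const (Ω := Fin N) () ▸
    uniformEntropy_le_of_forall fun _ _ _ => funext fun ⟨_, hl⟩ => absurd hl (notMem_empty _)

theorem meanEntropy_le_sum (S : Finset (Fin 4 × Fin 4)) :
    C.meanEntropy S ≤ ∑ l ∈ S, C.meanEntropy {l} := by
  induction S using Finset.induction_on with
  | empty => simpa using C.meanEntropy_empty_le
  | insert l S hl ih =>
    rw [sum_insert hl, insert_eq]
    exact (C.meanEntropy_union_le _ _).trans (by gcongr)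

theorem meanEntropy_diag_le [NeZero N] (i : Fin 4) : C.meanEntropy {(i, i)} ≤ Real.log Kd :=
  C.meanEntropy_le_of_forall fun σ => C.jointEntropy_diag_le σ i

theorem meanEntropy_offDiag_le [NeZero N] {i j : Fin 4} (hij : i ≠ j) :
    C.meanEntropy {(i, j)} ≤ Real.log K :=
  C.meanEntropy_le_of_forall fun σ => C.jointEntropy_offDiag_le σ hij

theorem log_card_le_of_labels (C : ExactRepairCode433 N Kd K) [NeZero N]
    {S : Finset (Fin 4 × Fin 4)} (k : Fin 4)
    (hS : ∀ i, i ≠ k → (i, i) ∈ repairClosure S) :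
    Real.log N ≤ ∑ l ∈ S, if l.1 = l.2 then Real.log Kd else Real.log K := by
  rw [← C.meanEntropy_eq_log k hS]
  refine (C.meanEntropy_le_sum S).trans (sum_le_sum fun ⟨i, j⟩ _ => ?_)
  split_ifs with h
  · obtain rfl : i = j := h
    exact C.meanEntropy_diag_le i
  · exact C.meanEntropy_offDiag_le h

theorem log_le_three_mul_log (C : ExactRepairCode433 N Kd K) [NeZero N] :
    Real.log N ≤ 3 * Real.log Kd := by
  have h := C.log_card_le_of_labels (S := {(0, 0), (1, 1), (2, 2)}) 3 (by decide +kernel)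
  simp at h
  linarith

theorem log_le_two_mul_log_add (C : ExactRepairCode433 N Kd K) [NeZero N] :
    Real.log N ≤ 2 * Real.log Kd + Real.log K := by
  have h := C.log_card_le_of_labels (S := {(0, 0), (1, 1), (3, 2)}) 3 (by decide +kernel)
  simp at h
  linarith

theorem log_le_six_mul_log (C : ExactRepairCode433 N Kd K) [NeZero N] :
    Real.log N ≤ 6 * Real.log K := by
  have h := C.log_card_le_of_labels
    (S := {(1, 0), (2, 0), (3, 0), (2, 1), (3, 1), (3, 2)}) 3 (by decide +kernel)
  simp at h
  linarith

theorem three_mul_log_le (C : ExactRepairCode433 N Kd K) [NeZero N] :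
    3 * Real.log N ≤ 4 * Real.log Kd + 6 * Real.log K := by
  have hW : C.meanEntropy {(0, 0)} ≤ Real.log Kd := C.meanEntropy_diag_le 0
  have hS : C.meanEntropy {(0, 1)} ≤ Real.log K := C.meanEntropy_offDiag_le (by decide)
  have hU : C.meanEntropy univ = Real.log N := C.meanEntropy_eq_log 0 (by decide +kernel)
  have e1 : C.meanEntropy {(0, 1), (3, 1)} ≤ C.meanEntropy {(0, 1)} + C.meanEntropy {(3, 1)} :=
    C.meanEntropy_union_le {(0, 1)} {(3, 1)}
  have e2 : C.meanEntropy {(3, 1)} ≤ C.meanEntropy {(0, 1)} :=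
    C.meanEntropy_le (.swap 0 3) (by decide +kernel)
  have e3 : C.meanEntropy {(0, 1), (2, 2)} ≤ C.meanEntropy {(0, 1)} + C.meanEntropy {(2, 2)} :=
    C.meanEntropy_union_le {(0, 1)} {(2, 2)}
  have e4 : C.meanEntropy {(2, 2)} ≤ C.meanEntropy {(0, 0)} :=
    C.meanEntropy_le (.swap 0 2) (by decide +kernel)
  have e5 : C.meanEntropy {(0, 1), (3, 1), (2, 2)} + C.meanEntropy {(0, 1)} ≤
      C.meanEntropy {(0, 1), (3, 1)} + C.meanEntropy {(0, 1), (2, 2)} :=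
    C.meanEntropy_submodular (by decide +kernel) (by decide +kernel)
  have e6 : C.meanEntropy {(1, 1), (2, 2), (0, 1)} ≤ C.meanEntropy {(0, 1), (3, 1), (2, 2)} :=
    C.meanEntropy_mono (by decide +kernel)
  have e7 : C.meanEntropy univ + C.meanEntropy {(0, 0), (1, 0)} ≤
      C.meanEntropy {(0, 0), (1, 0), (3, 1)} + C.meanEntropy {(0, 0), (1, 0), (2, 2)} :=
    C.meanEntropy_submodular (by decide +kernel) (by decide +kernel)
  have e8 : C.meanEntropy {(0, 0), (1, 0), (2, 2)} ≤ C.meanEntropy {(1, 1), (2, 2), (0, 1)} :=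
    C.meanEntropy_le (.swap 0 1) (by decide +kernel)
  have e9 : C.meanEntropy univ + C.meanEntropy {(0, 0), (1, 2), (2, 0)} ≤
      C.meanEntropy {(0, 0), (1, 2), (2, 2)} + C.meanEntropy {(0, 0), (1, 1), (2, 0)} :=
    C.meanEntropy_submodular (by decide +kernel) (by decide +kernel)
  have e10 : C.meanEntropy {(0, 0), (1, 2), (2, 2)} ≤ C.meanEntropy {(1, 1), (2, 2), (0, 1)} :=
    C.meanEntropy_le (.swap 0 2 * .swap 0 1) (by decide +kernel)
  have e11 : C.meanEntropy {(0, 0), (1, 1), (2, 0)} ≤ C.meanEntropy {(1, 1), (2, 2), (0, 1)} :=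
    C.meanEntropy_le (.swap 1 2 * .swap 0 1) (by decide +kernel)
  have e12 : C.meanEntropy {(0, 0), (1, 0), (3, 1)} ≤ C.meanEntropy {(0, 0), (1, 2), (2, 0)} :=
    C.meanEntropy_le (.swap 1 2 * .swap 1 3) (by decide +kernel)
  have e13 : C.meanEntropy {(0, 0), (1, 1)} + C.meanEntropy {(0, 1)} ≤
      C.meanEntropy {(0, 1), (1, 1)} + C.meanEntropy {(0, 0)} :=
    C.meanEntropy_submodular (by decide +kernel) (by decide +kernel)
  have e14 : C.meanEntropy {(0, 1), (1, 1)} ≤ C.meanEntropy {(0, 0), (1, 0)} :=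
    C.meanEntropy_le (.swap 0 1) (by decide +kernel)
  have e15 : C.meanEntropy univ + C.meanEntropy {(0, 0), (1, 2)} ≤
      C.meanEntropy {(0, 0), (2, 2), (1, 2), (3, 2)} + C.meanEntropy {(0, 0), (1, 1)} :=
    C.meanEntropy_submodular (by decide +kernel) (by decide +kernel)
  have e16 : C.meanEntropy {(0, 0), (2, 2), (1, 2), (3, 2)} ≤
      C.meanEntropy {(0, 1), (3, 1), (2, 2)} :=
    C.meanEntropy_le (.swap 0 1 * .swap 1 2) (by decide +kernel)
  have e17 : C.meanEntropy {(0, 1), (2, 2)} ≤ C.meanEntropy {(0, 0), (1, 2)} :=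
    C.meanEntropy_le (.swap 0 2 * .swap 1 2) (by decide +kernel)
  linarith

end ExactRepairCode433

namespace ExactRepairCode433

/-- A code over arbitrary finite alphabets, with the repair decoder left implicit. -/
theorem nonempty_of_fintype {Ω D E : Type} [Fintype Ω] [Fintype D] [Fintype E] [Nonempty D]
    (f : Fin 4 → Ω → D) (F : Fin 4 → Fin 4 → D → E)
    (hrec : ∀ k m m', (∀ i, i ≠ k → f i m = f i m') → m = m')
    (hrep : ∀ j m m', (∀ i, i ≠ j → F i j (f i m) = F i j (f i m')) → f j m = f j m') :
    Nonempty (ExactRepairCode433 (Fintype.card Ω) (Fintype.card D) (Fintype.card E)) := by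
  classical
  let eΩ := Fintype.equivFin Ω
  let eD := Fintype.equivFin D
  let eE := Fintype.equivFin E
  have hG (j : Fin 4) : ∃ G : ({i : Fin 4 // i ≠ j} → Fin (Fintype.card E)) → D,
      ∀ m, G (fun i => eE (F i.1 j (f i.1 m))) = f j m := by
    have hfac : Function.FactorsThrough (f j)
        (fun m (i : {i : Fin 4 // i ≠ j}) => eE (F i.1 j (f i.1 m))) := fun m m' h =>
      hrep j m m' fun i hi => eE.injective (congrFun h ⟨i, hi⟩)
    exact ⟨Function.extend _ (f j) fun _ => Classical.arbitrary D,
      fun m => hfac.extend_apply _ m⟩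
  choose G hG using hG
  refine ⟨⟨fun i m => eD (f i (eΩ.symm m)), fun i j d => eE (F i j (eD.symm d)),
    fun j x => eD (G j x), fun A hA m m' h => ?_, fun j m => ?_⟩⟩
  · obtain ⟨k, hk⟩ : ∃ k, Aᶜ = {k} := Finset.card_eq_one.1 (by simp [Finset.card_compl, hA])
    refine eΩ.symm.injective (hrec k _ _ fun i hi => eD.injective ?_)
    have hi' : i ∈ A := by
      rw [← not_not (a := i ∈ A), ← Finset.mem_compl, hk, Finset.mem_singleton]
      exact hi
    exact congrFun h ⟨i, hi'⟩
  · simp [hG]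

/-- The concatenation of two codes. -/
theorem nonempty_mul {N N' Kd Kd' K K' : ℕ} (hC : Nonempty (ExactRepairCode433 N Kd K))
    (hC' : Nonempty (ExactRepairCode433 N' Kd' K')) :
    Nonempty (ExactRepairCode433 (N * N') (Kd * Kd') (K * K')) := by
  obtain ⟨C⟩ := hC
  obtain ⟨C'⟩ := hC'
  refine ⟨⟨fun i m => finProdFinEquiv (Prod.map (C.f i) (C'.f i) (finProdFinEquiv.symm m)),
    fun i j d => finProdFinEquiv (Prod.map (C.F i j) (C'.F i j) (finProdFinEquiv.symm d)),
    fun j x => finProdFinEquiv (C.G j fun i => (finProdFinEquiv.symm (x i)).1,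
      C'.G j fun i => (finProdFinEquiv.symm (x i)).2), fun A hA m m' h => ?_, fun j m => ?_⟩⟩
  · refine finProdFinEquiv.symm.injective (Prod.ext ?_ ?_)
    · refine C.reconstruct A hA (funext fun i => ?_)
      exact congrArg Prod.fst (finProdFinEquiv.injective (congrFun h i))
    · refine C'.reconstruct A hA (funext fun i => ?_)
      exact congrArg Prod.snd (finProdFinEquiv.injective (congrFun h i))
  · simp [C.repair, C'.repair]

theorem nonempty_one : Nonempty (ExactRepairCode433 1 1 1) :=
  ⟨⟨fun _ _ => 0, fun _ _ _ => 0, fun _ _ => 0,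
    fun _ _ _ _ _ => Subsingleton.elim _ _, fun _ _ => Subsingleton.elim _ _⟩⟩

theorem nonempty_pow {N Kd K : ℕ} (hC : Nonempty (ExactRepairCode433 N Kd K)) (n : ℕ) :
    Nonempty (ExactRepairCode433 (N ^ n) (Kd ^ n) (K ^ n)) := by
  induction n with
  | zero => exact nonempty_one
  | succ n ih => exact nonempty_mul ih hC

/-- The single parity-check code. -/
theorem nonempty_minimum_storage : Nonempty (ExactRepairCode433 8 2 2) := by
  have := nonempty_of_fintype (Ω := Fin 3 → ZMod 2) (D := ZMod 2) (E := ZMod 2)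
    (fun i m => ![m 0, m 1, m 2, m 0 + m 1 + m 2] i) (fun _ _ d => d)
    (by decide +kernel) (by decide +kernel)
  simpa using this

/-- The code whose message symbols sit on the edges of the complete graph on the nodes. -/
theorem nonempty_minimum_bandwidth : Nonempty (ExactRepairCode433 64 8 2) := by
  let edge : Fin 4 → Fin 3 → Fin 6 := ![![0, 1, 2], ![0, 3, 4], ![1, 3, 5], ![2, 4, 5]]
  let pos : Fin 4 → Fin 4 → Fin 3 := ![![0, 0, 1, 2], ![0, 0, 1, 2], ![0, 1, 0, 2], ![0, 1, 2, 0]]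
  have := nonempty_of_fintype (Ω := Fin 6 → ZMod 2) (D := Fin 3 → ZMod 2) (E := ZMod 2)
    (fun i m k => m (edge i k)) (fun i j d => d (pos i j))
    (fun k m m' h => by
      have h' : ∀ i, i ≠ k → ∀ t, m (edge i t) = m' (edge i t) :=
        fun i hi t => congrFun (h i hi) t
      have hcover : ∀ k e, ∃ i, i ≠ k ∧ ∃ t, edge i t = e := by decide
      ext e
      obtain ⟨i, hi, t, rfl⟩ := hcover k e
      rw [h' i hi t])
    (fun j m m' h => by
      have hcover : ∀ j t, ∃ i, i ≠ j ∧ edge i (pos i j) = edge j t := by decide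
      ext t
      obtain ⟨i, hi, ht⟩ := hcover j t
      simpa only [ht] using h i hi)
  simpa using this

/-- The code that protects each triple of nodes by its own single parity-check code. -/
theorem nonempty_layered : Nonempty (ExactRepairCode433 256 8 4) := by
  let pos : Fin 4 → Fin 4 → Fin 3 := ![![0, 0, 1, 2], ![0, 0, 1, 2], ![0, 1, 0, 2], ![0, 1, 2, 0]]
  let x : (Fin 2 → ZMod 2) → Fin 3 → ZMod 2 := fun b => ![b 0, b 1, b 0 + b 1]
  have hx : ∀ s t u : Fin 3, s ≠ t → ∀ b b' : Fin 2 → ZMod 2, x b s = x b' s → x b t = x b' t →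
      x b u = x b' u ∧ b = b' := by decide +kernel
  have := nonempty_of_fintype (Ω := Fin 4 → Fin 2 → ZMod 2) (D := Fin 3 → ZMod 2)
    (E := Fin 2 → ZMod 2)
    (fun i m k => x (m (i.succAbove k)) (pos (i.succAbove k) i))
    (fun i j d t => d ((pos i j).succAbove t))
    (fun k m m' h => by
      have hcover : ∀ k l, ∃ i i' t t', i ≠ k ∧ i' ≠ k ∧ i.succAbove t = l ∧
        i'.succAbove t' = l ∧ pos l i ≠ pos l i' := by decide +kernel
      ext1 l
      obtain ⟨i, i', t, t', hi, hi', rfl, ht', hne⟩ := hcover k l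
      have h1 := congrFun (h i hi) t
      have h2 := congrFun (h i' hi') t'
      simp only [ht'] at h2
      exact (hx _ _ 0 hne _ _ h1 h2).2)
    (fun j m m' h => by
      have hcover : ∀ j k, ∃ i i' t t', i ≠ j ∧ i' ≠ j ∧
        i.succAbove ((pos i j).succAbove t) = j.succAbove k ∧
        i'.succAbove ((pos i' j).succAbove t') = j.succAbove k ∧
        pos (j.succAbove k) i ≠ pos (j.succAbove k) i' := by decide +kernel
      ext1 k
      obtain ⟨i, i', t, t', hi, hi', ht, ht', hne⟩ := hcover j k
      have h1 := congrFun (h i hi) t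
      have h2 := congrFun (h i' hi') t'
      simp only [ht] at h1
      simp only [ht'] at h2
      exact (hx _ _ _ hne _ _ h1 h2).1)
  simpa using this

theorem nonempty_two_pow (a b c : ℕ) :
    Nonempty (ExactRepairCode433 (2 ^ (3 * a + 8 * b + 6 * c)) (2 ^ (a + 3 * b + 3 * c))
      (2 ^ (a + 2 * b + c))) := by
  have h := nonempty_mul (nonempty_mul (nonempty_pow nonempty_minimum_storage a)
    (nonempty_pow nonempty_layered b)) (nonempty_pow nonempty_minimum_bandwidth c)
  rw [show 8 = 2 ^ 3 by norm_num, show 256 = 2 ^ 8 by norm_num, show 64 = 2 ^ 6 by norm_num,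
    show 4 = 2 ^ 2 by norm_num] at h
  simpa only [← pow_mul, ← pow_add, one_mul] using h

end ExactRepairCode433

open Filter Topology in
/-- Time sharing between the three extreme codes with weights `x`, `y`, `z`. -/
theorem achievable433_of_weights {α β x y z : ℝ} (hx : 0 ≤ x) (hy : 0 ≤ y) (hz : 0 ≤ z)
    (h1 : 3 * x + 8 * y + 6 * z = 1) (hα : x + 3 * y + 3 * z ≤ α) (hβ : x + 2 * y + z ≤ β) :
    Achievable433 α β := by
  intro ε hε
  have hlim {w : ℝ} (hw : 0 ≤ w) : Tendsto (fun n : ℕ => (⌊w * n⌋₊ : ℝ) / n) atTop (𝓝 w) :=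
    (tendsto_nat_floor_mul_div_atTop hw).comp tendsto_natCast_atTop_atTop
  have hX := hlim hx
  have hY := hlim hy
  have hZ := hlim hz
  have hT : Tendsto (fun n : ℕ => 3 * ((⌊x * n⌋₊ : ℝ) / n) + 8 * ((⌊y * n⌋₊ : ℝ) / n) +
      6 * ((⌊z * n⌋₊ : ℝ) / n)) atTop (𝓝 1) := by
    rw [← h1]
    exact ((hX.const_mul 3).add (hY.const_mul 8)).add (hZ.const_mul 6)
  have hA := (((hX.add (hY.const_mul 3)).add (hZ.const_mul 3)).div hT
    one_ne_zero).eventually_lt_const (show (x + 3 * y + 3 * z) / 1 < α + ε by linarith)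
  have hB := (((hX.add (hY.const_mul 2)).add hZ).div hT one_ne_zero).eventually_lt_const
    (show (x + 2 * y + z) / 1 < β + ε by linarith)
  obtain ⟨n, hn, hT, hA, hB⟩ := ((eventually_gt_atTop 0).and
    ((hT.eventually_const_lt zero_lt_one).and (hA.and hB))).exists
  have hn : (0 : ℝ) < n := by exact_mod_cast hn
  simp only [Pi.div_apply] at hA hB
  set a := ⌊x * n⌋₊
  set b := ⌊y * n⌋₊
  set c := ⌊z * n⌋₊
  have hTpos : (0 : ℝ) < 3 * a + 8 * b + 6 * c := by
    have := mul_pos hT hn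
    field_simp at this
    linarith
  have hpos : 0 < 3 * a + 8 * b + 6 * c := by exact_mod_cast hTpos
  have hlog : Real.log 2 ≠ 0 := (Real.log_pos one_lt_two).ne'
  refine ⟨_, _, _, ?_, ExactRepairCode433.nonempty_two_pow a b c, ?_, ?_⟩
  · exact Nat.le_self_pow hpos.ne' 2
  · push_cast
    rw [Real.log_pow, Real.log_pow, mul_div_mul_right _ _ hlog]
    push_cast
    refine le_trans (le_of_eq ?_) hA.le
    field_simp
  · push_cast
    rw [Real.log_pow, Real.log_pow, mul_div_mul_right _ _ hlog]
    push_cast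
    refine le_trans (le_of_eq ?_) hB.le
    field_simp

/-- The rate region of `(4,3,3)` exact-repair regenerating codes is exactly the
set of pairs `(ᾱ, β̄)` with `3ᾱ ≥ 1`, `2ᾱ + β̄ ≥ 1`, `4ᾱ + 6β̄ ≥ 3` and `6β̄ ≥ 1`. -/
theorem statement1 (α β : ℝ) :
    Achievable433 α β ↔
      (3 * α ≥ 1 ∧ 2 * α + β ≥ 1 ∧ 4 * α + 6 * β ≥ 3 ∧ 6 * β ≥ 1) := by
  constructor
  · intro h
    have key {p q r : ℝ} (hp : 0 ≤ p) (hq : 0 ≤ q) (hpq : 0 < p + q)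
        (hC : ∀ N Kd K : ℕ, 2 ≤ N → ExactRepairCode433 N Kd K →
          r * Real.log N ≤ p * Real.log Kd + q * Real.log K) : r ≤ p * α + q * β := by
      refine le_of_forall_pos_le_add fun δ hδ => ?_
      obtain ⟨N, Kd, K, hN, ⟨C⟩, hα, hβ⟩ := h (δ / (p + q)) (by positivity)
      have hlog : 0 < Real.log N := Real.log_pos (by exact_mod_cast hN)
      have hr : r ≤ p * (Real.log Kd / Real.log N) + q * (Real.log K / Real.log N) := by
        rw [← mul_div_assoc, ← mul_div_assoc, ← add_div, le_div_iff₀ hlog]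
        exact hC N Kd K hN C
      calc r ≤ p * (α + δ / (p + q)) + q * (β + δ / (p + q)) := by
            refine hr.trans ?_
            gcongr
        _ = p * α + q * β + δ := by
            field_simp
            ring
    refine ⟨?_, ?_, ?_, ?_⟩
    · have := key (p := 3) (q := 0) (r := 1) (by norm_num) le_rfl (by norm_num)
        fun N Kd K hN C => by
          have : NeZero N := ⟨by lia⟩
          linarith [C.log_le_three_mul_log]
      linarith
    · have := key (p := 2) (q := 1) (r := 1) (by norm_num) (by norm_num) (by norm_num)
        fun N Kd K hN C => by
          have : NeZero N := ⟨by lia⟩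
          linarith [C.log_le_two_mul_log_add]
      linarith
    · exact key (p := 4) (q := 6) (r := 3) (by norm_num) (by norm_num) (by norm_num)
        fun N Kd K hN C => by
          have : NeZero N := ⟨by lia⟩
          exact C.three_mul_log_le
    · have := key (p := 0) (q := 6) (r := 1) le_rfl (by norm_num) (by norm_num)
        fun N Kd K hN C => by
          have : NeZero N := ⟨by lia⟩
          linarith [C.log_le_six_mul_log]
      linarith
  · rintro ⟨h1, h2, h3, h4⟩
    rcases le_total α (3 / 8) with hα | hα
    · exact achievable433_of_weights (x := 3 - 8 * α) (y := 3 * α - 1) (z := 0)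
        (by linarith) (by linarith) le_rfl (by ring) (by linarith) (by linarith)
    rcases le_total α (1 / 2) with hα' | hα'
    · exact achievable433_of_weights (x := 0) (y := 1 / 2 - α) (z := (8 * α - 3) / 6)
        le_rfl (by linarith) (by linarith) (by ring) (by linarith) (by linarith)
    · exact achievable433_of_weights (x := 0) (y := 0) (z := 1 / 6)
        le_rfl le_rfl (by norm_num) (by norm_num) (by linarith) (by linarith)
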